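/- Let M be an invertible form. Then: (1) if N is an invertible form, M{N/x} is an invertible form and |M{N/x}| = |M|{|N|/x}; (2) if M rewrites in one step by a beta_{s₁,s₂} rule (app_{s₁,s₂} A B (abs_{s₁,s₂} A' B' P) N ↪ P N) to a term N', then N' is an invertible form and |M| reduces to |N'| in zero or more EPTS β-steps; (3) if M rewrites in one step by the framework β-rule or a rule El_{s₂} u_{s₁} ↪ U_{s₁} to N', then N' is an invertible form and |M| = |N'|; (4) if M rewrites in zero or more ↪_{β𝓡_EPTS} steps to N', then N' is an invertible form and |M| reduces to |N'| in zero or more EPTS steps. -/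

import Mathlib

namespace DKPaper

inductive Tm (C : Type) : Type
  | var : Nat → Tm C
  | const : C → List (Tm C) → Tm C
  | type : Tm C
  | kind : Tm C
  | app : Tm C → Tm C → Tm C
  | lam : Tm C → Tm C → Tm C
  | pi : Tm C → Tm C → Tm C

namespace Tm
variable {C : Type}

def liftRen (ρ : Nat → Nat) : Nat → Nat
  | 0 => 0
  | n + 1 => ρ n + 1

def ren (ρ : Nat → Nat) : Tm C → Tm C
  | var n => var (ρ n)
  | const c Ms => const c (Ms.attach.map fun x => ren ρ x.1)
  | type => type
  | kind => kind
  | app M N => app (ren ρ M) (ren ρ N)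
  | lam A M => lam (ren ρ A) (ren (liftRen ρ) M)
  | pi A B => pi (ren ρ A) (ren (liftRen ρ) B)
termination_by t => sizeOf t
decreasing_by
  all_goals simp_wf
  all_goals try omega
  all_goals (have h := List.sizeOf_lt_of_mem x.2; omega)

def liftSub (σ : Nat → Tm C) : Nat → Tm C
  | 0 => var 0
  | n + 1 => ren Nat.succ (σ n)

def sub (σ : Nat → Tm C) : Tm C → Tm C
  | var n => σ n
  | const c Ms => const c (Ms.attach.map fun x => sub σ x.1)
  | type => type
  | kind => kind
  | app M N => app (sub σ M) (sub σ N)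
  | lam A M => lam (sub σ A) (sub (liftSub σ) M)
  | pi A B => pi (sub σ A) (sub (liftSub σ) B)
termination_by t => sizeOf t
decreasing_by
  all_goals simp_wf
  all_goals try omega
  all_goals (have h := List.sizeOf_lt_of_mem x.2; omega)

/-- Substitution of `N` for the variable of de Bruijn index `k` (the usual `M{N/x}`). -/
def substAt (k : Nat) (N : Tm C) : Tm C → Tm C :=
  sub fun n => if n < k then var n else if n = k then ren (· + k) N else var (n - 1)

end Tm

/-! ## Signatures, rewrite rules, rewriting -/

/-- An entry `c[Δ] : A` of a signature: head constant, telescope (in declaration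
order, each entry a type under the previous ones), and the type. -/
abbrev Sig (C : Type) := Set (C × List (Tm C) × Tm C)

/-- A rewrite rule `c[l⃗] ↪ r`: head constant, list of left-hand side argument
patterns (free de Bruijn variables are the pattern variables), right-hand side. -/
abbrev Rules (C : Type) := Set (C × List (Tm C) × Tm C)

variable {C : Type}

/-- Closure of a root relation under all term-forming contexts. -/
inductive Cong (r : Tm C → Tm C → Prop) : Tm C → Tm C → Prop
  | base {M N} : r M N → Cong r M N
  | appL {M M' N} : Cong r M M' → Cong r (.app M N) (.app M' N)
  | appR {M N N'} : Cong r N N' → Cong r (.app M N) (.app M N')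
  | lamA {A A' M} : Cong r A A' → Cong r (.lam A M) (.lam A' M)
  | lamM {A M M'} : Cong r M M' → Cong r (.lam A M) (.lam A M')
  | piA {A A' B} : Cong r A A' → Cong r (.pi A B) (.pi A' B)
  | piB {A B B'} : Cong r B B' → Cong r (.pi A B) (.pi A B')
  | constArg {c l₁ M M' l₂} : Cong r M M' →
      Cong r (.const c (l₁ ++ M :: l₂)) (.const c (l₁ ++ M' :: l₂))

/-- Root β-reduction. -/
def BetaRoot : Tm C → Tm C → Prop := fun M N =>
  ∃ A P Q, M = .app (.lam A P) Q ∧ N = Tm.substAt 0 Q P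

/-- Root reduction by a rule of `R`: a substitution instance of some rule. -/
def RuleRoot (R : Rules C) : Tm C → Tm C → Prop := fun M N =>
  ∃ rl ∈ R, ∃ σ : Nat → Tm C,
    M = Tm.sub σ (.const rl.1 rl.2.1) ∧ N = Tm.sub σ rl.2.2

/-- One-step β-reduction `↪_β`. -/
def Beta : Tm C → Tm C → Prop := Cong BetaRoot

/-- One-step reduction by the rules of `R` only (no β). -/
def RStep (R : Rules C) : Tm C → Tm C → Prop := Cong (RuleRoot R)

/-- One-step reduction `↪_{β𝓡}`. -/
def Step (R : Rules C) : Tm C → Tm C → Prop :=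
  Cong (fun M N => BetaRoot M N ∨ RuleRoot R M N)

/-- The conversion `≡_{β𝓡}` generated by `↪_{β𝓡}`. -/
def Conv (R : Rules C) : Tm C → Tm C → Prop := Relation.EqvGen (Step R)

/-- Confluence of an abstract reduction relation. -/
def Confluent {α : Type _} (r : α → α → Prop) : Prop :=
  ∀ a b c, Relation.ReflTransGen r a b → Relation.ReflTransGen r a c →
    ∃ d, Relation.ReflTransGen r b d ∧ Relation.ReflTransGen r c d

/-- `M` is in β-normal form. -/
def BetaNormal (M : Tm C) : Prop := ∀ N, ¬ Beta M N

/-- Strong normalization of a relation at a point: no infinite `r`-sequence starts at `a`. -/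
def SN {α : Type _} (r : α → α → Prop) (a : α) : Prop := Acc (fun x y => r y x) a


/-! ## Dedukti typing -/

/-- `IsDKSort s` means `s` is `TYPE` or `KIND`. -/
def IsDKSort (s : Tm C) : Prop := s = Tm.type ∨ s = Tm.kind

/-- `A{M⃗}`: simultaneous instantiation of the telescope variables by the arguments. -/
def instArgs (Ms : List (Tm C)) (A : Tm C) : Tm C :=
  Tm.sub (fun n => Ms.reverse.getD n (Tm.var (n - Ms.length))) A

/-- Instantiate the first variable of the (remaining) telescope `Δ` with `M`. -/
def instTele (M : Tm C) (Δ : List (Tm C)) : List (Tm C) :=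
  Δ.mapIdx fun i B => Tm.substAt i M B

mutual
/-- Well-formed contexts `Σ;Γ well-formed` (de Bruijn: last declaration first). -/
inductive Wf (S : Sig C) (R : Rules C) : List (Tm C) → Prop
  | empty : Wf S R []
  | decl {Γ A} : Typed S R Γ A Tm.type → Wf S R (A :: Γ)

/-- The Dedukti typing judgment `Σ;Γ ⊢ M : A`. -/
inductive Typed (S : Sig C) (R : Rules C) : List (Tm C) → Tm C → Tm C → Prop
  | sort {Γ} : Wf S R Γ → Typed S R Γ Tm.type Tm.kind
  | var {Γ n A} : Wf S R Γ → Γ[n]? = some A →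
      Typed S R Γ (Tm.var n) (Tm.ren (· + (n + 1)) A)
  | cons {Γ c Δ A s Ms} : (c, Δ, A) ∈ S → Typed S R Δ.reverse A s → IsDKSort s →
      TypedArgs S R Γ Ms Δ → Typed S R Γ (Tm.const c Ms) (instArgs Ms A)
  | conv {Γ M A B s} : Typed S R Γ M A → Typed S R Γ B s → IsDKSort s →
      Conv R A B → Typed S R Γ M B
  | prod {Γ A B s} : Typed S R Γ A Tm.type → Typed S R (A :: Γ) B s → IsDKSort s →
      Typed S R Γ (Tm.pi A B) s
  | abs {Γ A B s M} : Typed S R Γ A Tm.type → Typed S R (A :: Γ) B s → IsDKSort s →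
      Typed S R (A :: Γ) M B → Typed S R Γ (Tm.lam A M) (Tm.pi A B)
  | app {Γ M N A B} : Typed S R Γ M (Tm.pi A B) → Typed S R Γ N A →
      Typed S R Γ (Tm.app M N) (Tm.substAt 0 N B)

/-- `Σ;Γ ⊢ M⃗ : Δ`: the arguments fit the telescope. -/
inductive TypedArgs (S : Sig C) (R : Rules C) : List (Tm C) → List (Tm C) → List (Tm C) → Prop
  | nil {Γ} : TypedArgs S R Γ [] []
  | cons {Γ M Ms A Δ} : Typed S R Γ M A → TypedArgs S R Γ Ms (instTele M Δ) →
      TypedArgs S R Γ (M :: Ms) (A :: Δ)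
end

/-! ## Type-level and object-level constants, syntactic classes -/

/-- Types of the form `Πx⃗:B⃗.TYPE`. -/
inductive IsKindShape : Tm C → Prop
  | type : IsKindShape Tm.type
  | pi {A K} : IsKindShape K → IsKindShape (Tm.pi A K)

/-- `c` is a type-level constant of the signature `S`. -/
def TypeLevel (S : Sig C) (c : C) : Prop := ∃ Δ A, (c, Δ, A) ∈ S ∧ IsKindShape A

/-- `c` is an object-level constant of the signature `S`: it is declared, and not type-level. -/
def ObjLevel (S : Sig C) (c : C) : Prop := (∃ Δ A, (c, Δ, A) ∈ S) ∧ ¬ TypeLevel S c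

mutual
/-- Kinds: `K ::= TYPE | Πx:T.K`. -/
inductive IsKind (S : Sig C) : Tm C → Prop
  | type : IsKind S Tm.type
  | pi {T K} : IsTypeFam S T → IsKind S K → IsKind S (Tm.pi T K)

/-- Type families: `T ::= α[O⃗] | T O | λx:T.T | Πx:T.T` with `α` type-level. -/
inductive IsTypeFam (S : Sig C) : Tm C → Prop
  | const {c Os} : TypeLevel S c → (∀ O ∈ Os, IsObj S O) → IsTypeFam S (Tm.const c Os)
  | app {T O} : IsTypeFam S T → IsObj S O → IsTypeFam S (Tm.app T O)
  | lam {T₁ T₂} : IsTypeFam S T₁ → IsTypeFam S T₂ → IsTypeFam S (Tm.lam T₁ T₂)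
  | pi {T₁ T₂} : IsTypeFam S T₁ → IsTypeFam S T₂ → IsTypeFam S (Tm.pi T₁ T₂)

/-- Objects: `O ::= x | a[O⃗] | O O | λx:T.O` with `a` object-level. -/
inductive IsObj (S : Sig C) : Tm C → Prop
  | var {n} : IsObj S (Tm.var n)
  | const {c Os} : ObjLevel S c → (∀ O ∈ Os, IsObj S O) → IsObj S (Tm.const c Os)
  | app {O₁ O₂} : IsObj S O₁ → IsObj S O₂ → IsObj S (Tm.app O₁ O₂)
  | lam {T O} : IsTypeFam S T → IsObj S O → IsObj S (Tm.lam T O)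
end

mutual
/-- Pre-kinds: `L ::= TYPE | Πx:R.L`. -/
inductive PreKind (S : Sig C) : Tm C → Prop
  | type : PreKind S Tm.type
  | pi {R L} : PreTypeFam S R → PreKind S L → PreKind S (Tm.pi R L)

/-- Pre-type families: `R ::= α[M⃗] | R N | λx:A.R | Πx:R.R` with `α` type-level
and `M⃗`, `N`, `A` arbitrary. -/
inductive PreTypeFam (S : Sig C) : Tm C → Prop
  | const {c Ms} : TypeLevel S c → PreTypeFam S (Tm.const c Ms)
  | app {R N} : PreTypeFam S R → PreTypeFam S (Tm.app R N)
  | lam {A R} : PreTypeFam S R → PreTypeFam S (Tm.lam A R)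
  | pi {R₁ R₂} : PreTypeFam S R₁ → PreTypeFam S R₂ → PreTypeFam S (Tm.pi R₁ R₂)
end

/-- A rewrite rule is type-level when its head constant is type-level. -/
def TypeLevelRule (S : Sig C) (rl : C × List (Tm C) × Tm C) : Prop := TypeLevel S rl.1

/-- The grammar `R ::= α[M⃗] | R N | λx:A.R` used to define arity preservation. -/
inductive APShape (S : Sig C) : Tm C → Prop
  | const {c Ms} : TypeLevel S c → APShape S (Tm.const c Ms)
  | app {R N} : APShape S R → APShape S (Tm.app R N)
  | lam {A R} : APShape S R → APShape S (Tm.lam A R)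

/-- `𝓡` is arity preserving (w.r.t. `Σ`). -/
def ArityPreserving (S : Sig C) (R : Rules C) : Prop :=
  ∀ rl ∈ R, TypeLevelRule S rl → APShape S rl.2.2

/-- `𝓡` is well-formed (w.r.t. `Σ`): right-hand sides of type-level rules are in
the grammar `R ::= α[M⃗] | R N | λx:B.R | Πx:R.R`. -/
def RulesWellFormed (S : Sig C) (R : Rules C) : Prop :=
  ∀ rl ∈ R, TypeLevelRule S rl → PreTypeFam S rl.2.2

/-! ## Simple types and the erasure maps -/

/-- Simple types `σ ::= * | σ → σ`. -/
inductive STy : Type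
  | star : STy
  | arr : STy → STy → STy
deriving DecidableEq

open Classical in
/-- The partial type erasure `⌈·⌉` from Dedukti terms to simple types. -/
noncomputable def tyErase (S : Sig C) : Tm C → Option STy
  | Tm.type => some STy.star
  | Tm.const c _ => if TypeLevel S c then some STy.star else none
  | Tm.pi A B => do return STy.arr (← tyErase S A) (← tyErase S B)
  | Tm.app A _ => tyErase S A
  | Tm.lam _ B => tyErase S B
  | Tm.var _ => none
  | Tm.kind => none

/-- Untyped λ-terms with constants in `K` (the target of the term erasure). -/
inductive LTm (K : Type) : Type
  | var : Nat → LTm K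
  | const : K → LTm K
  | app : LTm K → LTm K → LTm K
  | lam : LTm K → LTm K

namespace LTm
variable {K : Type}

def liftRen' (ρ : Nat → Nat) : Nat → Nat
  | 0 => 0
  | n + 1 => ρ n + 1

def ren (ρ : Nat → Nat) : LTm K → LTm K
  | var n => var (ρ n)
  | const k => const k
  | app M N => app (ren ρ M) (ren ρ N)
  | lam M => lam (ren (liftRen' ρ) M)

/-- Shift free variables `≥ d` up by one. -/
def shiftAbove (d : Nat) : LTm K → LTm K :=
  ren fun n => if n < d then n else n + 1

def liftSub (σ : Nat → LTm K) : Nat → LTm K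
  | 0 => var 0
  | n + 1 => ren Nat.succ (σ n)

def sub (σ : Nat → LTm K) : LTm K → LTm K
  | var n => σ n
  | const k => const k
  | app M N => app (sub σ M) (sub σ N)
  | lam M => lam (sub (liftSub σ) M)

/-- Substitution `M{N/x}` for the variable of index `k`. -/
def substAt (k : Nat) (N : LTm K) : LTm K → LTm K :=
  sub fun n => if n < k then var n else if n = k then ren (· + k) N else var (n - 1)

end LTm

/-- β-reduction for the (simply-typed) λ-calculus. -/
inductive LBeta {K : Type} : LTm K → LTm K → Prop
  | red {M N} : LBeta (LTm.app (LTm.lam M) N) (LTm.substAt 0 N M)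
  | appL {M M' N} : LBeta M M' → LBeta (LTm.app M N) (LTm.app M' N)
  | appR {M N N'} : LBeta N N' → LBeta (LTm.app M N) (LTm.app M N')
  | lam {M M'} : LBeta M M' → LBeta (LTm.lam M) (LTm.lam M')

/-- The partial term erasure `|·|` from Dedukti terms into the λ-calculus with
constants `C ⊕ STy` (`Sum.inr σ` being the constant `π_σ`). -/
noncomputable def erase (S : Sig C) : Tm C → Option (LTm (C ⊕ STy))
  | Tm.var n => some (LTm.var n)
  | Tm.const c Ms => do
      let ts ← Ms.attach.mapM fun x => erase S x.1
      return ts.foldl LTm.app (LTm.const (Sum.inl c))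
  | Tm.app M N => do return LTm.app (← erase S M) (← erase S N)
  | Tm.lam A M => do
      return LTm.app (LTm.lam (LTm.lam (LTm.shiftAbove 1 (← erase S M)))) (← erase S A)
  | Tm.pi A B => do
      return LTm.app (LTm.app (LTm.const (Sum.inr (← tyErase S A))) (← erase S A))
        (LTm.lam (← erase S B))
  | Tm.type => none
  | Tm.kind => none
termination_by t => sizeOf t
decreasing_by
  all_goals simp_wf
  all_goals try omega
  all_goals (have h := List.sizeOf_lt_of_mem x.2; omega)

/-- The type `* → (σ → *) → *` of the constant `π_σ`. -/
def piConstTy (σ : STy) : STy := STy.arr STy.star (STy.arr (STy.arr σ STy.star) STy.star)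

/-- `⌈A₁⌉ → ... → ⌈Aₙ⌉ → ⌈A⌉`, as a relation (defined when all erasures are). -/
inductive EraseTele (S : Sig C) : List (Tm C) → Tm C → STy → Prop
  | nil {A σ} : tyErase S A = some σ → EraseTele S [] A σ
  | cons {B Δ A τ σ} : tyErase S B = some τ → EraseTele S Δ A σ →
      EraseTele S (B :: Δ) A (STy.arr τ σ)

/-- The simply-typed constant context `Γ_π, ⌈Σ'⌉`: it declares `π_σ : * → (σ → *) → *`
for every simple type `σ`, and `c : ⌈A₁⌉ → ... → ⌈Aₙ⌉ → ⌈A⌉` for every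
declaration `c[x₁:A₁,...,xₙ:Aₙ] : A` of `Σ'` (erasures being taken w.r.t. `S`). -/
inductive ConstTy (S : Sig C) (S' : Sig C) : C ⊕ STy → STy → Prop
  | piConst (σ : STy) : ConstTy S S' (Sum.inr σ) (piConstTy σ)
  | const {c Δ A σ} : (c, Δ, A) ∈ S' → EraseTele S Δ A σ → ConstTy S S' (Sum.inl c) σ

/-- Typing in the simply-typed λ-calculus, with constants typed by `cty`. -/
inductive STTyped {K : Type} (cty : K → STy → Prop) : List STy → LTm K → STy → Prop
  | var {Γ n σ} : Γ[n]? = some σ → STTyped cty Γ (LTm.var n) σ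
  | const {Γ k σ} : cty k σ → STTyped cty Γ (LTm.const k) σ
  | app {Γ M N σ τ} : STTyped cty Γ M (STy.arr σ τ) → STTyped cty Γ N σ →
      STTyped cty Γ (LTm.app M N) τ
  | lam {Γ M σ τ} : STTyped cty (σ :: Γ) M τ → STTyped cty Γ (LTm.lam M) (STy.arr σ τ)

/-! ## Explicitly-typed Pure Type Systems (EPTS) -/

/-- EPTS terms (de Bruijn): `x | s | Π_{s₁,s₂}(A,[x]B) | λ_{s₁,s₂}(A,[x]B,[x]M) |
@_{s₁,s₂}(A,[x]B,M,N)`. -/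
inductive ETm (S : Type) : Type
  | var : Nat → ETm S
  | sort : S → ETm S
  | pi : S → S → ETm S → ETm S → ETm S
  | lam : S → S → ETm S → ETm S → ETm S → ETm S
  | app : S → S → ETm S → ETm S → ETm S → ETm S → ETm S

namespace ETm
variable {S : Type}

def ren (ρ : Nat → Nat) : ETm S → ETm S
  | var n => var (ρ n)
  | sort s => sort s
  | pi s₁ s₂ A B => pi s₁ s₂ (ren ρ A) (ren (Tm.liftRen ρ) B)
  | lam s₁ s₂ A B M => lam s₁ s₂ (ren ρ A) (ren (Tm.liftRen ρ) B) (ren (Tm.liftRen ρ) M)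
  | app s₁ s₂ A B M N => app s₁ s₂ (ren ρ A) (ren (Tm.liftRen ρ) B) (ren ρ M) (ren ρ N)

def liftSub (σ : Nat → ETm S) : Nat → ETm S
  | 0 => var 0
  | n + 1 => ren Nat.succ (σ n)

def sub (σ : Nat → ETm S) : ETm S → ETm S
  | var n => σ n
  | sort s => sort s
  | pi s₁ s₂ A B => pi s₁ s₂ (sub σ A) (sub (liftSub σ) B)
  | lam s₁ s₂ A B M => lam s₁ s₂ (sub σ A) (sub (liftSub σ) B) (sub (liftSub σ) M)
  | app s₁ s₂ A B M N => app s₁ s₂ (sub σ A) (sub (liftSub σ) B) (sub σ M) (sub σ N)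

/-- Substitution `M{N/x}` for the variable of de Bruijn index `k`. -/
def substAt (k : Nat) (N : ETm S) : ETm S → ETm S :=
  sub fun n => if n < k then var n else if n = k then ren (· + k) N else var (n - 1)

end ETm

variable {S : Type}

/-- Closure of a root relation under all EPTS term-forming contexts. -/
inductive ECong (r : ETm S → ETm S → Prop) : ETm S → ETm S → Prop
  | base {M N} : r M N → ECong r M N
  | piA {s₁ s₂ A A' B} : ECong r A A' → ECong r (.pi s₁ s₂ A B) (.pi s₁ s₂ A' B)
  | piB {s₁ s₂ A B B'} : ECong r B B' → ECong r (.pi s₁ s₂ A B) (.pi s₁ s₂ A B')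
  | lamA {s₁ s₂ A A' B M} : ECong r A A' → ECong r (.lam s₁ s₂ A B M) (.lam s₁ s₂ A' B M)
  | lamB {s₁ s₂ A B B' M} : ECong r B B' → ECong r (.lam s₁ s₂ A B M) (.lam s₁ s₂ A B' M)
  | lamM {s₁ s₂ A B M M'} : ECong r M M' → ECong r (.lam s₁ s₂ A B M) (.lam s₁ s₂ A B M')
  | appA {s₁ s₂ A A' B M N} : ECong r A A' → ECong r (.app s₁ s₂ A B M N) (.app s₁ s₂ A' B M N)
  | appB {s₁ s₂ A B B' M N} : ECong r B B' → ECong r (.app s₁ s₂ A B M N) (.app s₁ s₂ A B' M N)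
  | appM {s₁ s₂ A B M M' N} : ECong r M M' → ECong r (.app s₁ s₂ A B M N) (.app s₁ s₂ A B M' N)
  | appN {s₁ s₂ A B M N N'} : ECong r N N' → ECong r (.app s₁ s₂ A B M N) (.app s₁ s₂ A B M N')

/-- Root β-reduction of the EPTS (linearized rule, one instance per `(s₁,s₂,s₃) ∈ ℛ`):
`@_{s₁,s₂}(A,[x]B, λ_{s₁,s₂}(A',[x]B',[x]M), N) ↪ M{N/x}`. -/
def EBetaRoot (Rrel : S → S → S → Prop) : ETm S → ETm S → Prop := fun M N =>
  ∃ s₁ s₂ s₃ A B A' B' P Q, Rrel s₁ s₂ s₃ ∧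
    M = ETm.app s₁ s₂ A B (ETm.lam s₁ s₂ A' B' P) Q ∧ N = ETm.substAt 0 Q P

/-- One-step EPTS reduction. -/
def EStep (Rrel : S → S → S → Prop) : ETm S → ETm S → Prop := ECong (EBetaRoot Rrel)

/-- EPTS conversion `≡`. -/
def EConv (Rrel : S → S → S → Prop) : ETm S → ETm S → Prop := Relation.EqvGen (EStep Rrel)

mutual
/-- Well-formed EPTS contexts. -/
inductive EWf (Ar : S → S → Prop) (Rr : S → S → S → Prop) : List (ETm S) → Prop
  | empty : EWf Ar Rr []
  | decl {Γ A s} : ETyped Ar Rr Γ A (ETm.sort s) → EWf Ar Rr (A :: Γ)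

/-- The EPTS typing judgment `Γ ⊢ M : A`. -/
inductive ETyped (Ar : S → S → Prop) (Rr : S → S → S → Prop) : List (ETm S) → ETm S → ETm S → Prop
  | sort {Γ s₁ s₂} : EWf Ar Rr Γ → Ar s₁ s₂ → ETyped Ar Rr Γ (ETm.sort s₁) (ETm.sort s₂)
  | var {Γ n A} : EWf Ar Rr Γ → Γ[n]? = some A →
      ETyped Ar Rr Γ (ETm.var n) (ETm.ren (· + (n + 1)) A)
  | conv {Γ M A B s} : ETyped Ar Rr Γ M A → ETyped Ar Rr Γ B (ETm.sort s) →
      EConv Rr A B → ETyped Ar Rr Γ M B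
  | pi {Γ s₁ s₂ s₃ A B} : Rr s₁ s₂ s₃ → ETyped Ar Rr Γ A (ETm.sort s₁) →
      ETyped Ar Rr (A :: Γ) B (ETm.sort s₂) →
      ETyped Ar Rr Γ (ETm.pi s₁ s₂ A B) (ETm.sort s₃)
  | lam {Γ s₁ s₂ s₃ A B M} : Rr s₁ s₂ s₃ → ETyped Ar Rr Γ A (ETm.sort s₁) →
      ETyped Ar Rr (A :: Γ) B (ETm.sort s₂) → ETyped Ar Rr (A :: Γ) M B →
      ETyped Ar Rr Γ (ETm.lam s₁ s₂ A B M) (ETm.pi s₁ s₂ A B)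
  | app {Γ s₁ s₂ s₃ A B M N} : Rr s₁ s₂ s₃ → ETyped Ar Rr Γ A (ETm.sort s₁) →
      ETyped Ar Rr (A :: Γ) B (ETm.sort s₂) → ETyped Ar Rr Γ N A →
      ETyped Ar Rr Γ M (ETm.pi s₁ s₂ A B) →
      ETyped Ar Rr Γ (ETm.app s₁ s₂ A B M N) (ETm.substAt 0 N B)
end

/-- `𝒜` and `ℛ` are functional relations. -/
def FunctionalSpec (Ar : S → S → Prop) (Rr : S → S → S → Prop) : Prop :=
  (∀ s t t', Ar s t → Ar s t' → t = t') ∧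
  (∀ s₁ s₂ t t', Rr s₁ s₂ t → Rr s₁ s₂ t' → t = t')

/-- `s` is a top-sort. -/
def IsTopSort (Ar : S → S → Prop) (s : S) : Prop := ¬ ∃ s', Ar s s'

/-- `Γ ⊢ A type`: `A` is a sort, or `Γ ⊢ A : s` for some sort `s`. -/
def ETypeJ (Ar : S → S → Prop) (Rr : S → S → S → Prop) (Γ : List (ETm S)) (A : ETm S) : Prop :=
  (∃ s, A = ETm.sort s) ∨ ∃ s, ETyped Ar Rr Γ A (ETm.sort s)

/-! ## (Implicit) Pure Type Systems -/

/-- PTS terms. -/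
inductive PTm (S : Type) : Type
  | var : Nat → PTm S
  | sort : S → PTm S
  | pi : PTm S → PTm S → PTm S
  | lam : PTm S → PTm S → PTm S
  | app : PTm S → PTm S → PTm S

namespace PTm
variable {S : Type}

def ren (ρ : Nat → Nat) : PTm S → PTm S
  | var n => var (ρ n)
  | sort s => sort s
  | pi A B => pi (ren ρ A) (ren (Tm.liftRen ρ) B)
  | lam A M => lam (ren ρ A) (ren (Tm.liftRen ρ) M)
  | app M N => app (ren ρ M) (ren ρ N)

def liftSub (σ : Nat → PTm S) : Nat → PTm S
  | 0 => var 0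
  | n + 1 => ren Nat.succ (σ n)

def sub (σ : Nat → PTm S) : PTm S → PTm S
  | var n => σ n
  | sort s => sort s
  | pi A B => pi (sub σ A) (sub (liftSub σ) B)
  | lam A M => lam (sub σ A) (sub (liftSub σ) M)
  | app M N => app (sub σ M) (sub σ N)

def substAt (k : Nat) (N : PTm S) : PTm S → PTm S :=
  sub fun n => if n < k then var n else if n = k then ren (· + k) N else var (n - 1)

end PTm

/-- One-step β-reduction of PTS terms. -/
inductive PBeta : PTm S → PTm S → Prop
  | red {A M N} : PBeta (PTm.app (PTm.lam A M) N) (PTm.substAt 0 N M)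
  | piA {A A' B} : PBeta A A' → PBeta (PTm.pi A B) (PTm.pi A' B)
  | piB {A B B'} : PBeta B B' → PBeta (PTm.pi A B) (PTm.pi A B')
  | lamA {A A' M} : PBeta A A' → PBeta (PTm.lam A M) (PTm.lam A' M)
  | lamM {A M M'} : PBeta M M' → PBeta (PTm.lam A M) (PTm.lam A M')
  | appL {M M' N} : PBeta M M' → PBeta (PTm.app M N) (PTm.app M' N)
  | appR {M N N'} : PBeta N N' → PBeta (PTm.app M N) (PTm.app M N')

/-- PTS conversion. -/
def PConv : PTm S → PTm S → Prop := Relation.EqvGen PBeta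

mutual
/-- Well-formed PTS contexts. -/
inductive PWf (Ar : S → S → Prop) (Rr : S → S → S → Prop) : List (PTm S) → Prop
  | empty : PWf Ar Rr []
  | decl {Γ A s} : PTyped Ar Rr Γ A (PTm.sort s) → PWf Ar Rr (A :: Γ)

/-- The PTS typing judgment. -/
inductive PTyped (Ar : S → S → Prop) (Rr : S → S → S → Prop) : List (PTm S) → PTm S → PTm S → Prop
  | sort {Γ s₁ s₂} : PWf Ar Rr Γ → Ar s₁ s₂ → PTyped Ar Rr Γ (PTm.sort s₁) (PTm.sort s₂)
  | var {Γ n A} : PWf Ar Rr Γ → Γ[n]? = some A →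
      PTyped Ar Rr Γ (PTm.var n) (PTm.ren (· + (n + 1)) A)
  | conv {Γ M A B s} : PTyped Ar Rr Γ M A → PTyped Ar Rr Γ B (PTm.sort s) →
      PConv A B → PTyped Ar Rr Γ M B
  | pi {Γ s₁ s₂ s₃ A B} : Rr s₁ s₂ s₃ → PTyped Ar Rr Γ A (PTm.sort s₁) →
      PTyped Ar Rr (A :: Γ) B (PTm.sort s₂) →
      PTyped Ar Rr Γ (PTm.pi A B) (PTm.sort s₃)
  | lam {Γ s₁ s₂ s₃ A B M} : Rr s₁ s₂ s₃ → PTyped Ar Rr Γ A (PTm.sort s₁) →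
      PTyped Ar Rr (A :: Γ) B (PTm.sort s₂) → PTyped Ar Rr (A :: Γ) M B →
      PTyped Ar Rr Γ (PTm.lam A M) (PTm.pi A B)
  | app {Γ A B M N} : PTyped Ar Rr Γ M (PTm.pi A B) → PTyped Ar Rr Γ N A →
      PTyped Ar Rr Γ (PTm.app M N) (PTm.substAt 0 N B)
end

/-- `Γ ⊢_PTS A type`. -/
def PTypeJ (Ar : S → S → Prop) (Rr : S → S → S → Prop) (Γ : List (PTm S)) (A : PTm S) : Prop :=
  (∃ s, A = PTm.sort s) ∨ ∃ s, PTyped Ar Rr Γ A (PTm.sort s)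

/-- The natural erasure from EPTS terms to PTS terms. -/
def epsErase : ETm S → PTm S
  | ETm.var n => PTm.var n
  | ETm.sort s => PTm.sort s
  | ETm.pi _ _ A B => PTm.pi (epsErase A) (epsErase B)
  | ETm.lam _ _ A _ M => PTm.lam (epsErase A) (epsErase M)
  | ETm.app _ _ _ _ M N => PTm.app (epsErase M) (epsErase N)

/-! ## The encoding of EPTSs in Dedukti -/

/-- The constants of the theory `(Σ_EPTS, 𝓡_EPTS)`. -/
inductive EConst (S : Type) : Type
  | U : S → EConst S
  | El : S → EConst S
  | u : S → EConst S
  | Prod : S → S → EConst S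
  | abs : S → S → EConst S
  | app : S → S → EConst S

/-- `U_s`. -/
def Ucon (s : S) : Tm (EConst S) := Tm.const (EConst.U s) []
/-- `El_s A`. -/
def Elcon (s : S) (A : Tm (EConst S)) : Tm (EConst S) := Tm.const (EConst.El s) [A]
/-- `u_s`. -/
def ucon (s : S) : Tm (EConst S) := Tm.const (EConst.u s) []
/-- `Prod_{s₁,s₂} A B`. -/
def ProdC (s₁ s₂ : S) (A B : Tm (EConst S)) : Tm (EConst S) :=
  Tm.const (EConst.Prod s₁ s₂) [A, B]
/-- `abs_{s₁,s₂} A B M`. -/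
def absC (s₁ s₂ : S) (A B M : Tm (EConst S)) : Tm (EConst S) :=
  Tm.const (EConst.abs s₁ s₂) [A, B, M]
/-- `app_{s₁,s₂} A B M N`. -/
def appC (s₁ s₂ : S) (A B M N : Tm (EConst S)) : Tm (EConst S) :=
  Tm.const (EConst.app s₁ s₂) [A, B, M, N]

/-- The signature `Σ_EPTS` (telescopes in de Bruijn form). -/
inductive SigEPTSMem (Ar : S → S → Prop) (Rr : S → S → S → Prop) :
    EConst S × List (Tm (EConst S)) × Tm (EConst S) → Prop
  | U (s : S) : SigEPTSMem Ar Rr (EConst.U s, [], Tm.type)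
  | El (s : S) : SigEPTSMem Ar Rr (EConst.El s, [Ucon s], Tm.type)
  | u {s₁ s₂} : Ar s₁ s₂ → SigEPTSMem Ar Rr (EConst.u s₁, [], Ucon s₂)
  | Prod {s₁ s₂ s₃} : Rr s₁ s₂ s₃ →
      SigEPTSMem Ar Rr (EConst.Prod s₁ s₂,
        [Ucon s₁, Tm.pi (Elcon s₁ (Tm.var 0)) (Ucon s₂)],
        Ucon s₃)
  | abs {s₁ s₂ s₃} : Rr s₁ s₂ s₃ →
      SigEPTSMem Ar Rr (EConst.abs s₁ s₂,
        [Ucon s₁, Tm.pi (Elcon s₁ (Tm.var 0)) (Ucon s₂),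
         Tm.pi (Elcon s₁ (Tm.var 1)) (Elcon s₂ (Tm.app (Tm.var 1) (Tm.var 0)))],
        Elcon s₃ (ProdC s₁ s₂ (Tm.var 2) (Tm.var 1)))
  | app {s₁ s₂ s₃} : Rr s₁ s₂ s₃ →
      SigEPTSMem Ar Rr (EConst.app s₁ s₂,
        [Ucon s₁, Tm.pi (Elcon s₁ (Tm.var 0)) (Ucon s₂),
         Elcon s₃ (ProdC s₁ s₂ (Tm.var 1) (Tm.var 0)),
         Elcon s₁ (Tm.var 2)],
        Elcon s₂ (Tm.app (Tm.var 2) (Tm.var 0)))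

/-- `Σ_EPTS` as a signature. -/
def sigEPTS (Ar : S → S → Prop) (Rr : S → S → S → Prop) : Sig (EConst S) :=
  fun e => SigEPTSMem Ar Rr e

/-- The rules `El_{s₂} u_{s₁} ↪ U_{s₁}` for `(s₁,s₂) ∈ 𝒜`. -/
inductive URulesMem (Ar : S → S → Prop) :
    EConst S × List (Tm (EConst S)) × Tm (EConst S) → Prop
  | u_red {s₁ s₂} : Ar s₁ s₂ → URulesMem Ar (EConst.El s₂, [ucon s₁], Ucon s₁)

/-- The rules `app_{s₁,s₂} A B (abs_{s₁,s₂} A' B' M) N ↪ M N` for `(s₁,s₂,s₃) ∈ ℛ`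
(pattern variables `A,B,A',B',M,N` are the de Bruijn variables `0,…,5`). -/
inductive BetaRulesMem (Rr : S → S → S → Prop) :
    EConst S × List (Tm (EConst S)) × Tm (EConst S) → Prop
  | beta {s₁ s₂ s₃} : Rr s₁ s₂ s₃ →
      BetaRulesMem Rr (EConst.app s₁ s₂,
        [Tm.var 0, Tm.var 1, absC s₁ s₂ (Tm.var 2) (Tm.var 3) (Tm.var 4), Tm.var 5],
        Tm.app (Tm.var 4) (Tm.var 5))

/-- The `u_{s₁}`-red rules as a rule set. -/
def uRules (Ar : S → S → Prop) : Rules (EConst S) := fun e => URulesMem Ar e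

/-- The `beta_{s₁,s₂}` rules as a rule set. -/
def betaRules (Rr : S → S → S → Prop) : Rules (EConst S) := fun e => BetaRulesMem Rr e

/-- The rewrite system `𝓡_EPTS`. -/
def rulesEPTS (Ar : S → S → Prop) (Rr : S → S → S → Prop) : Rules (EConst S) :=
  uRules Ar ∪ betaRules Rr

/-- The translation `⟦·⟧` from EPTS terms to Dedukti terms. -/
def trans : ETm S → Tm (EConst S)
  | ETm.var n => Tm.var n
  | ETm.sort s => ucon s
  | ETm.pi s₁ s₂ A B =>
      ProdC s₁ s₂ (trans A) (Tm.lam (Elcon s₁ (trans A)) (trans B))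
  | ETm.lam s₁ s₂ A B M =>
      absC s₁ s₂ (trans A) (Tm.lam (Elcon s₁ (trans A)) (trans B))
        (Tm.lam (Elcon s₁ (trans A)) (trans M))
  | ETm.app s₁ s₂ A B M N =>
      appC s₁ s₂ (trans A) (Tm.lam (Elcon s₁ (trans A)) (trans B)) (trans M) (trans N)

/-- The translation `⟦·⟧` on (well-formed) contexts: `⟦Γ, x:A⟧ = ⟦Γ⟧, x : El_{s_A} ⟦A⟧`
where `Γ ⊢ A : s_A`. -/
inductive TransCtx (Ar : S → S → Prop) (Rr : S → S → S → Prop) :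
    List (ETm S) → List (Tm (EConst S)) → Prop
  | nil : TransCtx Ar Rr [] []
  | cons {Γ Δ A sA} : TransCtx Ar Rr Γ Δ → ETyped Ar Rr Γ A (ETm.sort sA) →
      TransCtx Ar Rr (A :: Γ) (Elcon sA (trans A) :: Δ)

/-- Invertible forms. -/
inductive Invertible : Tm (EConst S) → Prop
  | var {n} : Invertible (Tm.var n)
  | u {s} : Invertible (ucon s)
  | abs {s₁ s₂ A T₁ B T₂ M} : Invertible A → Invertible B → Invertible M →
      Invertible (absC s₁ s₂ A (Tm.lam T₁ B) (Tm.lam T₂ M))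
  | beta {T M N} : Invertible M → Invertible N →
      Invertible (Tm.app (Tm.lam T M) N)
  | prod {s₁ s₂ A T₁ B} : Invertible A → Invertible B →
      Invertible (ProdC s₁ s₂ A (Tm.lam T₁ B))
  | app {s₁ s₂ A T₁ B M N} : Invertible A → Invertible B → Invertible M → Invertible N →
      Invertible (appC s₁ s₂ A (Tm.lam T₁ B) M N)

/-- The inverse translation `|·|`, defined (at least) on invertible forms. -/
def inv : Tm (EConst S) → Option (ETm S)
  | Tm.var n => some (ETm.var n)
  | Tm.const (EConst.u s) [] => some (ETm.sort s)
  | Tm.app (Tm.lam _ M) N => do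
      return ETm.substAt 0 (← inv N) (← inv M)
  | Tm.const (EConst.Prod s₁ s₂) [A, Tm.lam _ B] => do
      return ETm.pi s₁ s₂ (← inv A) (← inv B)
  | Tm.const (EConst.abs s₁ s₂) [A, Tm.lam _ B, Tm.lam _ M] => do
      return ETm.lam s₁ s₂ (← inv A) (← inv B) (← inv M)
  | Tm.const (EConst.app s₁ s₂) [A, Tm.lam _ B, M, N] => do
      return ETm.app s₁ s₂ (← inv A) (← inv B) (← inv M) (← inv N)
  | _ => none
termination_by t => sizeOf t
decreasing_by
  all_goals simp_wf
  all_goals omega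

/-- Hidden rewriting steps: a `↪_{β𝓡}` step inside the type annotation of a binder. -/
def HStep (R : Rules (EConst S)) : Tm (EConst S) → Tm (EConst S) → Prop :=
  Cong fun M N => ∃ A A' P, Step R A A' ∧ M = Tm.lam A P ∧ N = Tm.lam A' P

/-- The hidden conversion `≡_H`. -/
def HConv (R : Rules (EConst S)) : Tm (EConst S) → Tm (EConst S) → Prop :=
  Relation.EqvGen (HStep R)


namespace ETm

theorem liftRen_comp (ρ θ : Nat → Nat) :
    (fun n => Tm.liftRen ρ (Tm.liftRen θ n)) = Tm.liftRen fun n => ρ (θ n) := by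
  funext n; cases n <;> rfl

theorem ren_ren (t : ETm S) (ρ θ : Nat → Nat) :
    ren ρ (ren θ t) = ren (fun n => ρ (θ n)) t := by
  induction t generalizing ρ θ <;> simp_all [ren, liftRen_comp]

theorem liftSub_liftRen (σ : Nat → ETm S) (ρ : Nat → Nat) :
    (fun n => liftSub σ (Tm.liftRen ρ n)) = liftSub fun n => σ (ρ n) := by
  funext n; cases n <;> rfl

theorem sub_ren (t : ETm S) (σ : Nat → ETm S) (ρ : Nat → Nat) :
    sub σ (ren ρ t) = sub (fun n => σ (ρ n)) t := by
  induction t generalizing σ ρ <;> simp_all [ren, sub, liftSub_liftRen]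

theorem ren_liftSub (σ : Nat → ETm S) (ρ : Nat → Nat) :
    (fun n => ren (Tm.liftRen ρ) (liftSub σ n)) = liftSub fun n => ren ρ (σ n) := by
  funext n
  cases n with
  | zero => rfl
  | succ n => simp only [liftSub, ren_ren]; rfl

theorem ren_sub (t : ETm S) (σ : Nat → ETm S) (ρ : Nat → Nat) :
    ren ρ (sub σ t) = sub (fun n => ren ρ (σ n)) t := by
  induction t generalizing σ ρ <;> simp_all [ren, sub, ren_liftSub]

theorem sub_liftSub (σ τ : Nat → ETm S) :
    (fun n => sub (liftSub τ) (liftSub σ n)) = liftSub fun n => sub τ (σ n) := by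
  funext n
  cases n with
  | zero => rfl
  | succ n => simp only [liftSub, sub_ren, ren_sub]

theorem sub_sub (t : ETm S) (σ τ : Nat → ETm S) :
    sub τ (sub σ t) = sub (fun n => sub τ (σ n)) t := by
  induction t generalizing σ τ <;> simp_all [sub, sub_liftSub]

theorem liftSub_var_comp (ρ : Nat → Nat) :
    liftSub (S := S) (fun n => var (ρ n)) = fun n => var (Tm.liftRen ρ n) := by
  funext n; cases n <;> rfl

theorem ren_eq_sub (t : ETm S) (ρ : Nat → Nat) : ren ρ t = sub (fun n => var (ρ n)) t := by
  induction t generalizing ρ <;> simp_all [ren, sub, liftSub_var_comp]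

theorem liftSub_var : liftSub (S := S) var = var := by
  funext n; cases n <;> rfl

theorem sub_var (t : ETm S) : sub var t = t := by
  induction t <;> simp_all [sub, liftSub_var]

/-- The substitution sending the variable `0` to `N` and lowering the other variables. -/
def inst (N : ETm S) : Nat → ETm S
  | 0 => N
  | n + 1 => var n

theorem substAt_zero (N M : ETm S) : substAt 0 N M = sub (inst N) M := by
  unfold substAt
  congr 1
  funext n
  cases n with
  | zero => simpa [inst, ren_eq_sub] using sub_var N
  | succ n => simp [inst]

theorem sub_substAt_zero (σ : Nat → ETm S) (N M : ETm S) :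
    sub σ (substAt 0 N M) = substAt 0 (sub σ N) (sub (liftSub σ) M) := by
  simp only [substAt_zero, sub_sub]
  congr 1
  funext n
  cases n with
  | zero => rfl
  | succ n => exact ((sub_ren (σ n) (inst (sub σ N)) Nat.succ).trans (sub_var _)).symm

theorem ren_substAt_zero (ρ : Nat → Nat) (N M : ETm S) :
    ren ρ (substAt 0 N M) = substAt 0 (ren ρ N) (ren (Tm.liftRen ρ) M) := by
  simp only [ren_eq_sub, sub_substAt_zero, liftSub_var_comp]

end ETm

/-- A relation on EPTS terms is stable under substitution. -/
def SubStable (q : ETm S → ETm S → Prop) : Prop :=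
  ∀ M N σ, q M N → q (ETm.sub σ M) (ETm.sub σ N)

theorem EBetaRoot.subStable (Rr : S → S → S → Prop) : SubStable (EBetaRoot Rr) := by
  rintro _ _ σ ⟨s₁, s₂, s₃, A, B, A', B', P, Q, h, rfl, rfl⟩
  exact ⟨s₁, s₂, s₃, _, _, _, _, _, _, h, rfl, ETm.sub_substAt_zero _ _ _⟩

theorem ECong.subStable {q : ETm S → ETm S → Prop} (hq : SubStable q) :
    SubStable (ECong q) := by
  intro M N σ h
  induction h generalizing σ with
  | base h => exact .base (hq _ _ _ h)
  | piA _ ih => exact .piA (ih _)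
  | piB _ ih => exact .piB (ih _)
  | lamA _ ih => exact .lamA (ih _)
  | lamB _ ih => exact .lamB (ih _)
  | lamM _ ih => exact .lamM (ih _)
  | appA _ ih => exact .appA (ih _)
  | appB _ ih => exact .appB (ih _)
  | appM _ ih => exact .appM (ih _)
  | appN _ ih => exact .appN (ih _)

/-- Zero or more steps of the context closure of `q`. -/
abbrev ESteps (q : ETm S → ETm S → Prop) : ETm S → ETm S → Prop :=
  Relation.ReflTransGen (ECong q)

namespace ESteps
variable {q : ETm S → ETm S → Prop}

theorem subStable (hq : SubStable q) : SubStable (ESteps q) := fun _ _ σ h =>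
  h.lift (ETm.sub σ) fun _ _ => ECong.subStable hq _ _ σ

theorem pi {s₁ s₂ : S} {A A' B B' : ETm S} (hA : ESteps q A A') (hB : ESteps q B B') :
    ESteps q (.pi s₁ s₂ A B) (.pi s₁ s₂ A' B') :=
  (hA.lift (fun A => ETm.pi s₁ s₂ A B) fun _ _ => .piA).trans
    (hB.lift (fun B => ETm.pi s₁ s₂ A' B) fun _ _ => .piB)

theorem lam {s₁ s₂ : S} {A A' B B' M M' : ETm S} (hA : ESteps q A A') (hB : ESteps q B B')
    (hM : ESteps q M M') : ESteps q (.lam s₁ s₂ A B M) (.lam s₁ s₂ A' B' M') :=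
  ((hA.lift (fun A => ETm.lam s₁ s₂ A B M) fun _ _ => .lamA).trans
    (hB.lift (fun B => ETm.lam s₁ s₂ A' B M) fun _ _ => .lamB)).trans
    (hM.lift (fun M => ETm.lam s₁ s₂ A' B' M) fun _ _ => .lamM)

theorem app {s₁ s₂ : S} {A A' B B' M M' N N' : ETm S} (hA : ESteps q A A')
    (hB : ESteps q B B') (hM : ESteps q M M') (hN : ESteps q N N') :
    ESteps q (.app s₁ s₂ A B M N) (.app s₁ s₂ A' B' M' N') :=
  (((hA.lift (fun A => ETm.app s₁ s₂ A B M N) fun _ _ => .appA).trans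
    (hB.lift (fun B => ETm.app s₁ s₂ A' B M N) fun _ _ => .appB)).trans
    (hM.lift (fun M => ETm.app s₁ s₂ A' B' M N) fun _ _ => .appM)).trans
    (hN.lift (fun N => ETm.app s₁ s₂ A' B' M' N) fun _ _ => .appN)

theorem liftSub (hq : SubStable q) {σ τ : Nat → ETm S} (h : ∀ n, ESteps q (σ n) (τ n))
    (n : Nat) : ESteps q (ETm.liftSub σ n) (ETm.liftSub τ n) := by
  cases n with
  | zero => exact .refl
  | succ n =>
    simp only [ETm.liftSub, ETm.ren_eq_sub]
    exact subStable hq _ _ _ (h n)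

theorem sub_pointwise (hq : SubStable q) (M : ETm S) {σ τ : Nat → ETm S}
    (h : ∀ n, ESteps q (σ n) (τ n)) : ESteps q (ETm.sub σ M) (ETm.sub τ M) := by
  induction M generalizing σ τ with
  | var n => exact h n
  | sort s => exact .refl
  | pi s₁ s₂ A B ihA ihB => exact pi (ihA h) (ihB (liftSub hq h))
  | lam s₁ s₂ A B M ihA ihB ihM =>
    exact lam (ihA h) (ihB (liftSub hq h)) (ihM (liftSub hq h))
  | app s₁ s₂ A B M N ihA ihB ihM ihN =>
    exact app (ihA h) (ihB (liftSub hq h)) (ihM h) (ihN h)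

theorem substAt_zero (hq : SubStable q) {M M' N N' : ETm S} (hM : ESteps q M M')
    (hN : ESteps q N N') : ESteps q (ETm.substAt 0 N M) (ETm.substAt 0 N' M') := by
  simp only [ETm.substAt_zero]
  refine (subStable hq _ _ _ hM).trans (sub_pointwise hq _ fun n => ?_)
  cases n with
  | zero => exact hN
  | succ n => exact .refl

end ESteps

/-- The graph of the inverse translation on invertible forms. -/
inductive InvTo : Tm (EConst S) → ETm S → Prop
  | var {n} : InvTo (Tm.var n) (ETm.var n)
  | u {s} : InvTo (ucon s) (ETm.sort s)
  | abs {s₁ s₂ A T₁ B T₂ M a b m} : InvTo A a → InvTo B b → InvTo M m →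
      InvTo (absC s₁ s₂ A (Tm.lam T₁ B) (Tm.lam T₂ M)) (ETm.lam s₁ s₂ a b m)
  | beta {T M N m n} : InvTo M m → InvTo N n →
      InvTo (Tm.app (Tm.lam T M) N) (ETm.substAt 0 n m)
  | prod {s₁ s₂ A T₁ B a b} : InvTo A a → InvTo B b →
      InvTo (ProdC s₁ s₂ A (Tm.lam T₁ B)) (ETm.pi s₁ s₂ a b)
  | app {s₁ s₂ A T₁ B M N a b m n} : InvTo A a → InvTo B b → InvTo M m → InvTo N n →
      InvTo (appC s₁ s₂ A (Tm.lam T₁ B) M N) (ETm.app s₁ s₂ a b m n)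

theorem Invertible.exists_invTo {M : Tm (EConst S)} (h : Invertible M) : ∃ m, InvTo M m := by
  induction h with
  | var => exact ⟨_, .var⟩
  | u => exact ⟨_, .u⟩
  | abs _ _ _ ihA ihB ihM =>
    obtain ⟨⟨_, hA⟩, ⟨_, hB⟩, ⟨_, hM⟩⟩ := And.intro ihA (And.intro ihB ihM)
    exact ⟨_, .abs hA hB hM⟩
  | beta _ _ ihM ihN =>
    obtain ⟨⟨_, hM⟩, ⟨_, hN⟩⟩ := And.intro ihM ihN
    exact ⟨_, .beta hM hN⟩
  | prod _ _ ihA ihB =>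
    obtain ⟨⟨_, hA⟩, ⟨_, hB⟩⟩ := And.intro ihA ihB
    exact ⟨_, .prod hA hB⟩
  | app _ _ _ _ ihA ihB ihM ihN =>
    obtain ⟨⟨_, hA⟩, ⟨_, hB⟩, ⟨_, hM⟩, ⟨_, hN⟩⟩ :=
      And.intro ihA (And.intro ihB (And.intro ihM ihN))
    exact ⟨_, .app hA hB hM hN⟩

namespace InvTo

theorem invertible {M : Tm (EConst S)} {m : ETm S} (h : InvTo M m) : Invertible M := by
  induction h with
  | var => exact .var
  | u => exact .u
  | abs _ _ _ ihA ihB ihM => exact .abs ihA ihB ihM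
  | beta _ _ ihM ihN => exact .beta ihM ihN
  | prod _ _ ihA ihB => exact .prod ihA ihB
  | app _ _ _ _ ihA ihB ihM ihN => exact .app ihA ihB ihM ihN

theorem inv_eq {M : Tm (EConst S)} {m : ETm S} (h : InvTo M m) : inv M = some m := by
  induction h <;> simp_all [inv, ucon, absC, ProdC, appC]

theorem ren {M : Tm (EConst S)} {m : ETm S} (h : InvTo M m) (ρ : Nat → Nat) :
    InvTo (Tm.ren ρ M) (ETm.ren ρ m) := by
  induction h generalizing ρ with
  | var => simpa [Tm.ren, ETm.ren] using InvTo.var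
  | u => simpa [Tm.ren, ETm.ren, ucon] using InvTo.u
  | abs _ _ _ ihA ihB ihM =>
    simpa [Tm.ren, ETm.ren, absC] using InvTo.abs (ihA ρ) (ihB _) (ihM _)
  | beta _ _ ihM ihN =>
    simpa [Tm.ren, ETm.ren_substAt_zero] using InvTo.beta (ihM _) (ihN ρ)
  | prod _ _ ihA ihB =>
    simpa [Tm.ren, ETm.ren, ProdC] using InvTo.prod (ihA ρ) (ihB _)
  | app _ _ _ _ ihA ihB ihM ihN =>
    simpa [Tm.ren, ETm.ren, appC] using InvTo.app (ihA ρ) (ihB _) (ihM ρ) (ihN ρ)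

theorem liftSub {σ : Nat → Tm (EConst S)} {τ : Nat → ETm S} (h : ∀ n, InvTo (σ n) (τ n))
    (n : Nat) : InvTo (Tm.liftSub σ n) (ETm.liftSub τ n) := by
  cases n with
  | zero => exact .var
  | succ n => exact (h n).ren _

theorem sub {M : Tm (EConst S)} {m : ETm S} (h : InvTo M m) {σ : Nat → Tm (EConst S)}
    {τ : Nat → ETm S} (hσ : ∀ n, InvTo (σ n) (τ n)) : InvTo (Tm.sub σ M) (ETm.sub τ m) := by
  induction h generalizing σ τ with
  | var => simpa [Tm.sub, ETm.sub] using hσ _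
  | u => simpa [Tm.sub, ETm.sub, ucon] using InvTo.u
  | abs _ _ _ ihA ihB ihM =>
    simpa [Tm.sub, ETm.sub, absC] using
      InvTo.abs (ihA hσ) (ihB (liftSub hσ)) (ihM (liftSub hσ))
  | beta _ _ ihM ihN =>
    simpa [Tm.sub, ETm.sub_substAt_zero] using InvTo.beta (ihM (liftSub hσ)) (ihN hσ)
  | prod _ _ ihA ihB =>
    simpa [Tm.sub, ETm.sub, ProdC] using InvTo.prod (ihA hσ) (ihB (liftSub hσ))
  | app _ _ _ _ ihA ihB ihM ihN =>
    simpa [Tm.sub, ETm.sub, appC] using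
      InvTo.app (ihA hσ) (ihB (liftSub hσ)) (ihM hσ) (ihN hσ)

theorem substAt {M N : Tm (EConst S)} {m n : ETm S} (hM : InvTo M m) (hN : InvTo N n)
    (k : Nat) : InvTo (Tm.substAt k N M) (ETm.substAt k n m) := by
  refine hM.sub fun i => ?_
  split_ifs
  · exact .var
  · exact hN.ren _
  · exact .var

end InvTo

/-- One step in exactly one entry of a list of arguments. -/
inductive CongArgs (r : Tm C → Tm C → Prop) : List (Tm C) → List (Tm C) → Prop
  | head {M M' l} : Cong r M M' → CongArgs r (M :: l) (M' :: l)
  | tail {M l l'} : CongArgs r l l' → CongArgs r (M :: l) (M :: l')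

theorem Cong.const_inv {r : Tm C → Tm C → Prop} {c : C} {l : List (Tm C)} {N : Tm C}
    (h : Cong r (.const c l) N) :
    r (.const c l) N ∨ ∃ l', N = .const c l' ∧ CongArgs r l l' := by
  generalize hM : Tm.const c l = M at h
  cases h with
  | base h => exact .inl h
  | @constArg _ l₁ P P' l₂ h =>
    obtain ⟨rfl, rfl⟩ := Tm.const.inj hM
    refine .inr ⟨_, rfl, ?_⟩
    clear hM
    induction l₁ with
    | nil => exact .head h
    | cons _ _ ih => exact .tail ih
  | _ => cases hM

/-- Every root step of `r` out of an invertible form is simulated by `q`-steps of its inverse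
translation, and `r` has no root step out of an abstraction. -/
structure Simulates (q : ETm S → ETm S → Prop) (r : Tm (EConst S) → Tm (EConst S) → Prop) :
    Prop where
  root : ∀ {M m N}, InvTo M m → r M N → ∃ n, InvTo N n ∧ ESteps q m n
  not_lam : ∀ {T M N}, ¬ r (Tm.lam T M) N

theorem Simulates.cong_lam {q : ETm S → ETm S → Prop} {r : Tm (EConst S) → Tm (EConst S) → Prop}
    (hr : Simulates q r) {T M N : Tm (EConst S)} {m : ETm S} (hM : InvTo M m)
    (ih : ∀ {N}, Cong r M N → ∃ n, InvTo N n ∧ ESteps q m n) (h : Cong r (.lam T M) N) :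
    ∃ T' M' m', N = .lam T' M' ∧ InvTo M' m' ∧ ESteps q m m' := by
  cases h with
  | base h => exact (hr.not_lam h).elim
  | lamA h => exact ⟨_, _, _, rfl, hM, .refl⟩
  | lamM h =>
    obtain ⟨n, hn, hs⟩ := ih h
    exact ⟨_, _, _, rfl, hn, hs⟩

theorem Simulates.cong {q : ETm S → ETm S → Prop} (hq : SubStable q)
    {r : Tm (EConst S) → Tm (EConst S) → Prop} (hr : Simulates q r) {M N : Tm (EConst S)}
    {m : ETm S} (hM : InvTo M m) (h : Cong r M N) : ∃ n, InvTo N n ∧ ESteps q m n := by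
  induction hM generalizing N with
  | var =>
    cases h with
    | base h => exact hr.root .var h
  | u =>
    rcases h.const_inv with h | ⟨l', rfl, hl⟩
    · exact hr.root .u h
    · cases hl
  | abs hA hB hP ihA ihB ihP =>
    rcases h.const_inv with h | ⟨l', rfl, hl⟩
    · exact hr.root (.abs hA hB hP) h
    · rcases hl with g | g | g | g | ⟨⟩
      · obtain ⟨n, hn, hs⟩ := ihA g
        exact ⟨_, .abs hn hB hP, .lam hs .refl .refl⟩
      · obtain ⟨T, B', n, rfl, hn, hs⟩ := hr.cong_lam hB ihB g
        exact ⟨_, .abs hA hn hP, .lam .refl hs .refl⟩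
      · obtain ⟨T, P', n, rfl, hn, hs⟩ := hr.cong_lam hP ihP g
        exact ⟨_, .abs hA hB hn, .lam .refl .refl hs⟩
  | beta hP hQ ihP ihQ =>
    cases h with
    | base h => exact hr.root (.beta hP hQ) h
    | appL h =>
      obtain ⟨T, P', n, rfl, hn, hs⟩ := hr.cong_lam hP ihP h
      exact ⟨_, .beta hn hQ, .substAt_zero hq hs .refl⟩
    | appR h =>
      obtain ⟨n, hn, hs⟩ := ihQ h
      exact ⟨_, .beta hP hn, .substAt_zero hq .refl hs⟩
  | prod hA hB ihA ihB =>
    rcases h.const_inv with h | ⟨l', rfl, hl⟩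
    · exact hr.root (.prod hA hB) h
    · rcases hl with g | g | g | ⟨⟩
      · obtain ⟨n, hn, hs⟩ := ihA g
        exact ⟨_, .prod hn hB, .pi hs .refl⟩
      · obtain ⟨T, B', n, rfl, hn, hs⟩ := hr.cong_lam hB ihB g
        exact ⟨_, .prod hA hn, .pi .refl hs⟩
  | app hA hB hP hQ ihA ihB ihP ihQ =>
    rcases h.const_inv with h | ⟨l', rfl, hl⟩
    · exact hr.root (.app hA hB hP hQ) h
    · rcases hl with g | g | g | g | g | ⟨⟩
      · obtain ⟨n, hn, hs⟩ := ihA g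
        exact ⟨_, .app hn hB hP hQ, .app hs .refl .refl .refl⟩
      · obtain ⟨T, B', n, rfl, hn, hs⟩ := hr.cong_lam hB ihB g
        exact ⟨_, .app hA hn hP hQ, .app .refl hs .refl .refl⟩
      · obtain ⟨n, hn, hs⟩ := ihP g
        exact ⟨_, .app hA hB hn hQ, .app .refl .refl hs .refl⟩
      · obtain ⟨n, hn, hs⟩ := ihQ g
        exact ⟨_, .app hA hB hP hn, .app .refl .refl .refl hs⟩

theorem simulates_betaRoot (q : ETm S → ETm S → Prop) : Simulates q BetaRoot where
  root := by
    rintro _ m _ hM ⟨A, P, Q, rfl, rfl⟩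
    cases hM with
    | beta hP hQ => exact ⟨_, hP.substAt hQ 0, .refl⟩
  not_lam := by
    rintro _ _ _ ⟨_, _, _, h, _⟩
    cases h

theorem simulates_uRules (q : ETm S → ETm S → Prop) (Ar : S → S → Prop) :
    Simulates q (RuleRoot (uRules Ar)) where
  root := by
    rintro _ m _ hM ⟨_, ⟨_⟩, σ, rfl, rfl⟩
    simp only [Tm.sub] at hM
    cases hM
  not_lam := by
    rintro _ _ _ ⟨_, _, _, h, _⟩
    simp [Tm.sub] at h

theorem simulates_betaRules (Rr : S → S → S → Prop) :
    Simulates (EBetaRoot Rr) (RuleRoot (betaRules Rr)) where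
  root := by
    rintro M m _ hM ⟨_, ⟨hR⟩, σ, h, rfl⟩
    simp only [Tm.sub, absC, List.attach_cons, List.attach_nil, List.map_cons, List.map_nil] at h ⊢
    cases hM <;> simp only [ucon, absC, ProdC, appC, Tm.const.injEq, EConst.app.injEq,
      List.cons.injEq, reduceCtorEq, and_false] at h
    case app hA hB hP hQ =>
      obtain ⟨⟨rfl, rfl⟩, rfl, hσ, rfl, rfl, -⟩ := h
      generalize σ 3 = B', σ 4 = P at hP ⊢
      cases hP with
      | abs _ _ hP =>
        exact ⟨_, .beta hP hQ,
          .single (.base ⟨_, _, _, _, _, _, _, _, _, hR, rfl, rfl⟩)⟩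
  not_lam := by
    rintro _ _ _ ⟨_, _, _, h, _⟩
    simp [Tm.sub] at h

theorem simulates_rulesEPTS (Ar : S → S → Prop) (Rr : S → S → S → Prop) :
    Simulates (EBetaRoot Rr) fun M N => BetaRoot M N ∨ RuleRoot (rulesEPTS Ar Rr) M N where
  root := by
    rintro M m N hM (h | ⟨rl, h | h, hrl⟩)
    · exact (simulates_betaRoot _).root hM h
    · exact (simulates_uRules _ Ar).root hM ⟨rl, h, hrl⟩
    · exact (simulates_betaRules Rr).root hM ⟨rl, h, hrl⟩
  not_lam := by
    rintro T M N (h | ⟨rl, h | h, hrl⟩)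
    · exact (simulates_betaRoot (EBetaRoot Rr)).not_lam h
    · exact (simulates_uRules (EBetaRoot Rr) Ar).not_lam ⟨rl, h, hrl⟩
    · exact (simulates_betaRules Rr).not_lam ⟨rl, h, hrl⟩

theorem ECong.not_of_empty {M N : ETm S} : ¬ ECong (fun _ _ => False) M N := by
  intro h
  induction h <;> assumption

theorem Simulates.cong_eq {r : Tm (EConst S) → Tm (EConst S) → Prop}
    (hr : Simulates (fun _ _ => False) r) {M N : Tm (EConst S)} {m : ETm S} (hM : InvTo M m)
    (h : Cong r M N) : InvTo N m := by
  obtain ⟨n, hn, hs⟩ := hr.cong (fun _ _ _ => id) hM h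
  rcases hs.cases_head with rfl | ⟨_, h, _⟩
  · exact hn
  · exact (ECong.not_of_empty h).elim

/-- Invertible forms are closed under substitution and rewriting,
and rewriting is reflected by the inverse translation. -/
theorem invertible_closed_and_reflect {S : Type} (Ar : S → S → Prop) (Rr : S → S → S → Prop)
    (hfun : FunctionalSpec Ar Rr)
    {M : Tm (EConst S)} (hM : Invertible M) :
    (∀ (N : Tm (EConst S)) (k : Nat), Invertible N →
      Invertible (Tm.substAt k N M) ∧
      ∃ m n, inv M = some m ∧ inv N = some n ∧
        inv (Tm.substAt k N M) = some (ETm.substAt k n m)) ∧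
    (∀ N' : Tm (EConst S), RStep (betaRules Rr) M N' →
      Invertible N' ∧ ∃ m n', inv M = some m ∧ inv N' = some n' ∧
        Relation.ReflTransGen (EStep Rr) m n') ∧
    (∀ N' : Tm (EConst S), (Beta M N' ∨ RStep (uRules Ar) M N') →
      Invertible N' ∧ ∃ m n', inv M = some m ∧ inv N' = some n' ∧ m = n') ∧
    (∀ N' : Tm (EConst S), Relation.ReflTransGen (Step (rulesEPTS Ar Rr)) M N' →
      Invertible N' ∧ ∃ m n', inv M = some m ∧ inv N' = some n' ∧
        Relation.ReflTransGen (EStep Rr) m n') := by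
  obtain ⟨m, hm⟩ := hM.exists_invTo
  refine ⟨fun N k hN => ?_, fun N' h => ?_, fun N' h => ?_, fun N' h => ?_⟩
  · obtain ⟨n, hn⟩ := hN.exists_invTo
    have hs := hm.substAt hn k
    exact ⟨hs.invertible, m, n, hm.inv_eq, hn.inv_eq, hs.inv_eq⟩
  · obtain ⟨n, hn, hs⟩ := (simulates_betaRules Rr).cong (EBetaRoot.subStable Rr) hm h
    exact ⟨hn.invertible, m, n, hm.inv_eq, hn.inv_eq, hs⟩
  · have hn : InvTo N' m :=
      h.elim ((simulates_betaRoot _).cong_eq hm) ((simulates_uRules _ Ar).cong_eq hm)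
    exact ⟨hn.invertible, m, m, hm.inv_eq, hn.inv_eq, rfl⟩
  · obtain ⟨n, hn, hs⟩ : ∃ n, InvTo N' n ∧ Relation.ReflTransGen (EStep Rr) m n := by
      induction h with
      | refl => exact ⟨m, hm, .refl⟩
      | tail _ h ih =>
        obtain ⟨p, hp, hmp⟩ := ih
        obtain ⟨n, hn, hpn⟩ :=
          (simulates_rulesEPTS Ar Rr).cong (EBetaRoot.subStable Rr) hp h
        exact ⟨n, hn, hmp.trans hpn⟩
    exact ⟨hn.invertible, m, n, hm.inv_eq, hn.inv_eq, hs⟩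

end DKPaper
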